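/- (Discrete energy dissipation for the Cahn–Hilliard–Darcy scheme.) Let d ≥ 1, γ > 0, τ > 0, let f : ℝ → ℝ be continuously differentiable, let m, α : ℝ → ℝ be continuous with m ≥ 0 and α ≥ 0, let φⁿ, φⁿ⁺¹, μⁿ⁺¹, pⁿ⁺¹ : ℝ^d → ℝ and vⁿ⁺¹ : ℝ^d → ℝ^d be continuously differentiable and ℤ^d-periodic. Define F(a,b) := ∫₀¹ f′(b + s(a − b)) ds and d_τφ := (φⁿ⁺¹ − φⁿ)/τ. Suppose: (i) ⟨ d_τφ, μⁿ⁺¹ ⟩ − ⟨ φⁿ⁺¹ vⁿ⁺¹, ∇μⁿ⁺¹ ⟩ + ⟨ m(φⁿ⁺¹) ∇μⁿ⁺¹, ∇μⁿ⁺¹ ⟩ = 0; (ii) ⟨ μⁿ⁺¹, d_τφ ⟩ − γ ⟨ ∇φⁿ⁺¹, ∇ d_τφ ⟩ − ⟨ F(φⁿ⁺¹, φⁿ), d_τφ ⟩ = 0; (iii) ⟨ α(φⁿ⁺¹) vⁿ⁺¹, vⁿ⁺¹ ⟩ − ⟨ pⁿ⁺¹, div(vⁿ⁺¹) ⟩ +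 ⟨ φⁿ⁺¹ ∇μⁿ⁺¹, vⁿ⁺¹ ⟩ = 0; (iv) ⟨ div(vⁿ⁺¹), pⁿ⁺¹ ⟩ = 0; where ⟨·,·⟩ is the L² inner product over the unit cube Ω = [0,1]^d. Then E₀(φⁿ⁺¹) + τ ⟨ m(φⁿ⁺¹) ∇μⁿ⁺¹, ∇μⁿ⁺¹ ⟩ + τ ⟨ α(φⁿ⁺¹) vⁿ⁺¹, vⁿ⁺¹ ⟩ ≤ E₀(φⁿ), where E₀(φ) = ∫_Ω ( (γ/2)|∇φ|² + f(φ) ) dx. -/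

import Mathlib

open MeasureTheory

/-- The `i`-th partial derivative of a function `g : ℝ^d → ℝ`. -/
noncomputable def pderiv {d : ℕ} (g : (Fin d → ℝ) → ℝ) (i : Fin d) (x : Fin d → ℝ) : ℝ :=
  fderiv ℝ g x (Pi.single i 1)

/-- `ℤ^d`-periodicity of a function on `ℝ^d`. -/
def ZdPeriodic {d : ℕ} {E : Type*} (g : (Fin d → ℝ) → E) : Prop :=
  ∀ (x : Fin d → ℝ) (k : Fin d → ℤ), g (x + fun i => (k i : ℝ)) = g x

/-- The time-averaged potential derivative `F(a,b) = ∫₀¹ f′(b + s(a−b)) ds`. -/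
noncomputable def timeAvgF (f : ℝ → ℝ) (a b : ℝ) : ℝ :=
  ∫ s in (0:ℝ)..1, deriv f (b + s * (a - b))

/-- The partial derivatives of a `C¹` function are continuous. -/
theorem continuous_pderiv {d : ℕ} {g : (Fin d → ℝ) → ℝ} (hg : ContDiff ℝ 1 g) (i : Fin d) :
    Continuous (pderiv g i) :=
  (hg.continuous_fderiv one_ne_zero).clm_apply continuous_const

/-- Partial derivatives of a difference quotient. -/
theorem pderiv_sub_div {d : ℕ} {g h : (Fin d → ℝ) → ℝ} {x : Fin d → ℝ}
    (hg : DifferentiableAt ℝ g x) (hh : DifferentiableAt ℝ h x) (τ : ℝ) (i : Fin d) :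
    pderiv (fun y => (g y - h y) / τ) i x = (pderiv g i x - pderiv h i x) / τ := by
  have key := ((hg.hasFDerivAt.sub hh.hasFDerivAt).mul_const τ⁻¹).fderiv
  unfold pderiv
  simp only [div_eq_mul_inv]
  refine (congrArg (fun L : (Fin d → ℝ) →L[ℝ] ℝ => L (Pi.single i 1)) key).trans ?_
  simp [mul_comm]

/-- The discrete chain rule for the time-averaged potential derivative. -/
theorem timeAvgF_mul_sub {f : ℝ → ℝ} (hf : ContDiff ℝ 1 f) (a b : ℝ) :
    timeAvgF f a b * (a - b) = f a - f b := by
  have hd : ∀ s ∈ Set.uIcc (0 : ℝ) 1,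
      HasDerivAt (fun s => f (b + s * (a - b))) (deriv f (b + s * (a - b)) * (a - b)) s := by
    intro s _
    have h1 : HasDerivAt (fun s : ℝ => b + s * (a - b)) (a - b) s := by
      simpa using ((hasDerivAt_id s).mul_const (a - b)).const_add b
    exact ((hf.differentiable one_ne_zero) _).hasDerivAt.comp s h1
  have hc : Continuous fun s : ℝ => deriv f (b + s * (a - b)) * (a - b) :=
    ((hf.continuous_deriv le_rfl).comp (by fun_prop)).mul continuous_const
  have key := intervalIntegral.integral_eq_sub_of_hasDerivAt hd (hc.intervalIntegrable 0 1)
  rw [intervalIntegral.integral_mul_const] at key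
  simpa [timeAvgF] using key

/-- Discrete energy dissipation for the Cahn–Hilliard–Darcy scheme:
`E₀(φⁿ⁺¹) + τ⟨m(φⁿ⁺¹)∇μⁿ⁺¹, ∇μⁿ⁺¹⟩ + τ⟨α(φⁿ⁺¹)vⁿ⁺¹, vⁿ⁺¹⟩ ≤ E₀(φⁿ)`
over the unit cube `Ω = [0,1]^d`. -/
theorem CHD_discrete_energy_dissipation (d : ℕ) (hd : 1 ≤ d)
    (γ τ : ℝ) (hγ : 0 < γ) (hτ : 0 < τ)
    (f : ℝ → ℝ) (hf : ContDiff ℝ 1 f)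
    (m α : ℝ → ℝ) (hm : Continuous m) (hα : Continuous α)
    (hm0 : ∀ s : ℝ, 0 ≤ m s) (hα0 : ∀ s : ℝ, 0 ≤ α s)
    (φn φn1 μn1 pn1 : (Fin d → ℝ) → ℝ) (vn1 : (Fin d → ℝ) → Fin d → ℝ)
    (hφn : ContDiff ℝ 1 φn) (hφn1 : ContDiff ℝ 1 φn1) (hμn1 : ContDiff ℝ 1 μn1)
    (hpn1 : ContDiff ℝ 1 pn1) (hvn1 : ContDiff ℝ 1 vn1)
    (hφnper : ZdPeriodic φn) (hφn1per : ZdPeriodic φn1) (hμn1per : ZdPeriodic μn1)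
    (hpn1per : ZdPeriodic pn1) (hvn1per : ZdPeriodic vn1)
    (hi : (∫ x in Set.Icc (0 : Fin d → ℝ) 1, (φn1 x - φn x) / τ * μn1 x) -
        (∫ x in Set.Icc (0 : Fin d → ℝ) 1,
          ∑ i, φn1 x * vn1 x i * pderiv μn1 i x) +
        (∫ x in Set.Icc (0 : Fin d → ℝ) 1,
          m (φn1 x) * ∑ i, (pderiv μn1 i x) ^ 2) = 0)
    (hii : (∫ x in Set.Icc (0 : Fin d → ℝ) 1, μn1 x * ((φn1 x - φn x) / τ)) -
        γ * (∫ x in Set.Icc (0 : Fin d → ℝ) 1,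
          ∑ i, pderiv φn1 i x * pderiv (fun y => (φn1 y - φn y) / τ) i x) -
        (∫ x in Set.Icc (0 : Fin d → ℝ) 1,
          timeAvgF f (φn1 x) (φn x) * ((φn1 x - φn x) / τ)) = 0)
    (hiii : (∫ x in Set.Icc (0 : Fin d → ℝ) 1,
          α (φn1 x) * ∑ i, (vn1 x i) ^ 2) -
        (∫ x in Set.Icc (0 : Fin d → ℝ) 1,
          pn1 x * ∑ i, pderiv (fun y => vn1 y i) i x) +
        (∫ x in Set.Icc (0 : Fin d → ℝ) 1,
          ∑ i, φn1 x * pderiv μn1 i x * vn1 x i) = 0)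
    (hiv : (∫ x in Set.Icc (0 : Fin d → ℝ) 1,
        (∑ i, pderiv (fun y => vn1 y i) i x) * pn1 x) = 0) :
    (∫ x in Set.Icc (0 : Fin d → ℝ) 1,
        (γ / 2 * ∑ i, (pderiv φn1 i x) ^ 2 + f (φn1 x))) +
      τ * (∫ x in Set.Icc (0 : Fin d → ℝ) 1,
        m (φn1 x) * ∑ i, (pderiv μn1 i x) ^ 2) +
      τ * (∫ x in Set.Icc (0 : Fin d → ℝ) 1,
        α (φn1 x) * ∑ i, (vn1 x i) ^ 2) ≤
      ∫ x in Set.Icc (0 : Fin d → ℝ) 1,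
        (γ / 2 * ∑ i, (pderiv φn i x) ^ 2 + f (φn x)) := by
  have h0 := continuous_pderiv hφn
  have h1 := continuous_pderiv hφn1
  have c0 := hφn.continuous
  have c1 := hφn1.continuous
  have cf := hf.continuous
  have hF : ∀ x, timeAvgF f (φn1 x) (φn x) * ((φn1 x - φn x) / τ) =
      (f (φn1 x) - f (φn x)) / τ := fun x => by
    rw [← timeAvgF_mul_sub hf, mul_div_assoc]
  have hG : ∀ x i, pderiv (fun y => (φn1 y - φn y) / τ) i x =
      (pderiv φn1 i x - pderiv φn i x) / τ := fun x i =>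
    pderiv_sub_div (hφn1.differentiable one_ne_zero x) (hφn.differentiable one_ne_zero x) τ i
  simp only [hF, hG] at hii
  have hint {g : (Fin d → ℝ) → ℝ} (hg : Continuous g) :
      IntegrableOn g (Set.Icc (0 : Fin d → ℝ) 1) := hg.integrableOn_Icc
  have i0 := hint (g := fun x => γ / 2 * ∑ i, (pderiv φn i x) ^ 2 + f (φn x)) (by fun_prop)
  have i1 := hint (g := fun x => γ / 2 * ∑ i, (pderiv φn1 i x) ^ 2 + f (φn1 x)) (by fun_prop)
  have iG := hint (g := fun x =>
    ∑ i, pderiv φn1 i x * ((pderiv φn1 i x - pderiv φn i x) / τ)) (by fun_prop)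
  have iH := hint (g := fun x => (f (φn1 x) - f (φn x)) / τ) (by fun_prop)
  have energy_le := setIntegral_mono (μ := volume) i1
    (i0.add (((iG.const_mul γ).add iH).const_mul τ)) fun x => by
      have hsum : ∑ i, ((pderiv φn1 i x) ^ 2 - (pderiv φn i x) ^ 2) ≤
          ∑ i, 2 * τ * (pderiv φn1 i x * ((pderiv φn1 i x - pderiv φn i x) / τ)) := by
        refine Finset.sum_le_sum fun i _ => ?_
        have : 2 * τ * (pderiv φn1 i x * ((pderiv φn1 i x - pderiv φn i x) / τ)) =
            2 * (pderiv φn1 i x * (pderiv φn1 i x - pderiv φn i x)) := by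
          field_simp
        nlinarith [sq_nonneg (pderiv φn1 i x - pderiv φn i x)]
      rw [← Finset.mul_sum, Finset.sum_sub_distrib] at hsum
      have hf' : τ * ((f (φn1 x) - f (φn x)) / τ) = f (φn1 x) - f (φn x) := by field_simp
      simp only [Pi.add_apply]
      nlinarith [mul_le_mul_of_nonneg_left hsum (half_pos hγ).le]
  rw [integral_add' i0 (((iG.const_mul γ).add iH).const_mul τ), integral_const_mul,
    integral_add' (iG.const_mul γ) iH, integral_const_mul] at energy_le
  have comm_μ : (∫ x in Set.Icc (0 : Fin d → ℝ) 1, (φn1 x - φn x) / τ * μn1 x) =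
      ∫ x in Set.Icc (0 : Fin d → ℝ) 1, μn1 x * ((φn1 x - φn x) / τ) := by
    simp only [mul_comm]
  have comm_v : (∫ x in Set.Icc (0 : Fin d → ℝ) 1, ∑ i, φn1 x * vn1 x i * pderiv μn1 i x) =
      ∫ x in Set.Icc (0 : Fin d → ℝ) 1, ∑ i, φn1 x * pderiv μn1 i x * vn1 x i := by
    simp only [mul_right_comm]
  have comm_p : (∫ x in Set.Icc (0 : Fin d → ℝ) 1,
        (∑ i, pderiv (fun y => vn1 y i) i x) * pn1 x) =
      ∫ x in Set.Icc (0 : Fin d → ℝ) 1, pn1 x * ∑ i, pderiv (fun y => vn1 y i) i x := by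
    simp only [mul_comm]
  rw [comm_μ, comm_v] at hi
  rw [comm_p] at hiv
  refine (add_assoc _ _ _).trans_le ((add_le_add_left energy_le _).trans_eq ?_)
  linear_combination τ * (hi - hii + hiii + hiv)
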